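/- The set of subfields F of the algebraic closure of ℚ that are both PAC and Hilbertian is a comeager subset of the space 𝓔 of all subfields of the algebraic closure of ℚ. -/

import Mathlib

open FirstOrder Topology

noncomputable section

/-- `Q̄`, the algebraic closure of `ℚ`. -/
abbrev Qbar : Type := AlgebraicClosure ℚ

/-- `Prop` with the discrete two-point topology. -/
def propDiscrete : TopologicalSpace Prop := ⊥

/-- The product topology on the powerset `2^Q̄`, identified with `Set Q̄ = Q̄ → Prop`,
where each factor `Prop` carries the discrete two-point topology. -/
def powersetTopology : TopologicalSpace (Set Qbar) :=
  @Pi.topologicalSpace Qbar (fun _ => Prop) (fun _ => propDiscrete)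

/-- The space `𝓔` of all subfields of `Q̄`, with the subspace topology induced from `2^Q̄`
via the identification of a subfield with its underlying set of elements. -/
instance subfieldTopology : TopologicalSpace (Subfield Qbar) :=
  powersetTopology.induced (fun F => (F : Set Qbar))

/-- A subfield `F` of `Q̄` is PAC if every polynomial `f ∈ F[X,Y]` that is absolutely
irreducible (i.e. whose image in `Q̄[X,Y]` is irreducible) has a zero `(x,y) ∈ F × F`. -/
def IsPAC (F : Subfield Qbar) : Prop :=
  ∀ f : MvPolynomial (Fin 2) F,
    Irreducible (MvPolynomial.map F.subtype f) →
    ∃ x y : F, MvPolynomial.eval ![x, y] f = 0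

/-- A subfield `F` of `Q̄` is Hilbertian if for all `n ≥ 1`, all absolutely irreducible
`f₁, …, fₙ ∈ F[X,Y]` (viewed as polynomials in `Y` over `F[X]`) that are monic of degree
at least `2` in `Y`, and all nonzero `g ∈ F[X]`, there is `x ∈ F` with `g(x) ≠ 0` such that
each one-variable polynomial `fᵢ(x,Y)` has no root in `F`. -/
def IsHilbertian (F : Subfield Qbar) : Prop :=
  ∀ (n : ℕ), 0 < n → ∀ (f : Fin n → Polynomial (Polynomial F)) (g : Polynomial F),
    (∀ i, Irreducible ((f i).map (Polynomial.mapRingHom F.subtype))) →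
    (∀ i, (f i).Monic) →
    (∀ i, 2 ≤ (f i).natDegree) →
    g ≠ 0 →
    ∃ x : F, Polynomial.eval x g ≠ 0 ∧
      ∀ i, ∀ y : F, Polynomial.eval y ((f i).map (Polynomial.evalRingHom x)) ≠ 0

section

open Polynomial NumberField

/-- Newton's approximation of a root of `F` modulo powers of an ideal. -/
theorem exists_eval_mem_pow_of_eval_mem {S : Type*} [CommRing S] {I : Ideal S} {F : S[X]} {a u : S}
    (ha : F.eval a ∈ I) (hu : u * F.derivative.eval a - 1 ∈ I) (r : ℕ) :
    ∃ b, b - a ∈ I ∧ F.eval b ∈ I ^ (r + 1) := by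
  induction r with
  | zero => exact ⟨a, by simp, by simpa using ha⟩
  | succ r ih =>
    obtain ⟨b, hb, hFb⟩ := ih
    have hFb' : F.eval b ∈ I := Ideal.pow_le_self (Nat.succ_ne_zero r) hFb
    refine ⟨b + -(u * F.eval b), ?_, ?_⟩
    · have := I.sub_mem hb (I.mul_mem_left u hFb')
      convert this using 1
      ring
    · obtain ⟨c, hc⟩ := F.binomExpansion b (-(u * F.eval b))
      obtain ⟨d, hd⟩ := F.derivative.evalSubFactor b a
      have h1 : u * F.derivative.eval b - 1 ∈ I := by
        have : u * F.derivative.eval b - 1 =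
            (u * F.derivative.eval a - 1) + u * (d * (b - a)) := by rw [← hd]; ring
        rw [this]
        exact I.add_mem hu (I.mul_mem_left _ (I.mul_mem_left _ hb))
      have h2 : F.eval (b + -(u * F.eval b)) =
          F.eval b * (-(u * F.derivative.eval b - 1) + c * u ^ 2 * F.eval b) := by
        rw [hc]; ring
      rw [h2, pow_succ]
      exact Ideal.mul_mem_mul hFb (I.add_mem (I.neg_mem h1) (I.mul_mem_left _ hFb'))

/-- Two approximate roots that agree modulo `m` agree modulo `m ^ r`, at a simple root. -/
theorem pow_dvd_sub_of_eval_eq_zero {O : Type*} [CommRing O] {F : O[X]} {m y z : O} {r : ℕ}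
    (hy : F.eval y = 0) (hz : m ^ r ∣ F.eval z) (hyz : m ∣ y - z)
    (hm : IsCoprime m (F.derivative.eval y)) : m ^ r ∣ y - z := by
  obtain ⟨c, hc⟩ := F.binomExpansion y (z - y)
  rw [add_sub_cancel, hy, zero_add] at hc
  have h1 : F.eval z = (y - z) * -(F.derivative.eval y + c * (z - y)) := by rw [hc]; ring
  have h2 : IsCoprime m (-(F.derivative.eval y + c * (z - y))) := by
    obtain ⟨w, hw⟩ := hyz
    have h3 : c * (z - y) = m * (-(c * w)) := by linear_combination (-c) * hw
    rw [h3]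
    exact (IsCoprime.add_mul_left_right hm _).neg_right
  rw [h1] at hz
  exact (IsCoprime.pow_left h2).dvd_of_dvd_mul_right hz

/-- Lagrange interpolation through naturals has rational weights. -/
theorem exists_int_mul_eval_interpolate (K : Type*) [Field K] [CharZero K] (S : Finset ℕ) (t : ℕ) :
    ∃ (n : ℤ) (w : ℕ → ℤ), n ≠ 0 ∧ ∀ y : ℕ → K,
      n * (Lagrange.interpolate S (fun a : ℕ => (a : K)) y).eval (t : K) =
        ∑ a ∈ S, (w a : K) * y a := by
  let v : ℕ → ℤ := fun a => ∏ b ∈ S.erase a, ((a : ℤ) - b)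
  have hv : ∀ a, v a ≠ 0 := fun a => Finset.prod_ne_zero_iff.2 fun b hb => by
    have := Finset.ne_of_mem_erase hb
    simp only [ne_eq, sub_eq_zero, Nat.cast_inj]
    exact fun h => this h.symm
  refine ⟨∏ a ∈ S, v a, fun a => (∏ a' ∈ S.erase a, v a') * ∏ b ∈ S.erase a, ((t : ℤ) - b),
    Finset.prod_ne_zero_iff.2 fun a _ => hv a, fun y => ?_⟩
  rw [Lagrange.interpolate_apply, eval_finsetSum, Finset.mul_sum]
  refine Finset.sum_congr rfl fun a ha => ?_
  have hva : ((v a : ℤ) : K) ≠ 0 := by exact_mod_cast hv a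
  have hb : (Lagrange.basis S (fun a : ℕ => (a : K)) a).eval (t : K) =
      (v a : K)⁻¹ * ∏ b ∈ S.erase a, ((t : K) - b) := by
    simp [Lagrange.basis, Lagrange.basisDivisor, eval_prod, v, Finset.prod_mul_distrib]
  rw [eval_mul, eval_C, hb, ← Finset.mul_prod_erase _ _ ha]
  push_cast
  field_simp

/-- A polynomial agrees modulo `M ^ #S` with its interpolation along the naturals `M * a`. -/
theorem pow_dvd_interpolation_defect {K : Type*} [Field K] [NumberField K] {S : Finset ℕ} {t : ℕ}
    {n : ℤ} {w : ℕ → ℤ}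
    (hw : ∀ y : ℕ → K, n * (Lagrange.interpolate S (fun a : ℕ => (a : K)) y).eval (t : K) =
        ∑ a ∈ S, (w a : K) * y a) (P : (𝓞 K)[X]) (M : ℕ) :
    (M : 𝓞 K) ^ S.card ∣ n * P.eval ((M : 𝓞 K) * t) -
      ∑ a ∈ S, (w a : 𝓞 K) * P.eval ((M : 𝓞 K) * a) := by
  set k := S.card
  have hinj : Set.InjOn (fun a : ℕ => (a : K)) S := fun a _ b _ h => by simpa using h
  have hmon : (X ^ k : (𝓞 K)[X]).Monic := monic_X_pow k
  set L := P %ₘ X ^ k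
  have hP : ∀ a : ℕ, (M : 𝓞 K) ^ k ∣ P.eval ((M : 𝓞 K) * a) - L.eval ((M : 𝓞 K) * a) := fun a => by
    have h := congrArg (eval ((M : 𝓞 K) * a)) (modByMonic_add_div P (X ^ k))
    rw [eval_add, eval_mul, eval_pow, eval_X] at h
    rw [← h, add_sub_cancel_left, mul_pow, mul_assoc]
    exact dvd_mul_right _ _
  have hL : (n : 𝓞 K) * L.eval ((M : 𝓞 K) * t) =
      ∑ a ∈ S, (w a : 𝓞 K) * L.eval ((M : 𝓞 K) * a) := by
    apply RingOfIntegers.coe_injective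
    let Q : K[X] := (L.map (algebraMap (𝓞 K) K)).comp (C (M : K) * X)
    have hQe : ∀ a : ℕ, Q.eval (a : K) = algebraMap (𝓞 K) K (L.eval ((M : 𝓞 K) * a)) := fun a => by
      simp only [Q, eval_comp, eval_mul, eval_C, eval_X, eval_map_algebraMap]
      rw [← aeval_algebraMap_apply_eq_algebraMap_eval]
      simp
    have hdeg : Q.degree < S.card := by
      by_cases hM : M = 0
      · subst hM
        simp only [Q, Nat.cast_zero, C_0, zero_mul, comp_zero]
        rcases Nat.eq_zero_or_pos k with hk | hk
        · have : L = 0 := by simp [L, hk]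
          simp [this, hk, k, bot_lt_iff_ne_bot]
        · refine lt_of_le_of_lt degree_C_le ?_
          exact_mod_cast hk
      · have hM' : (M : K) ≠ 0 := by exact_mod_cast hM
        have h1 : L.degree < k := by
          simpa using degree_modByMonic_lt P hmon
        rcases eq_or_ne L 0 with h0 | h0
        · simp [Q, h0, bot_lt_iff_ne_bot]
        · have h2 : L.natDegree < k := (natDegree_lt_iff_degree_lt h0).2 h1
          refine lt_of_le_of_lt degree_le_natDegree ?_
          have : Q.natDegree ≤ L.natDegree * 1 := by
            refine natDegree_comp_le.trans (Nat.mul_le_mul natDegree_map_le ?_)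
            exact (natDegree_C_mul_le _ _).trans natDegree_X_le
          exact_mod_cast lt_of_le_of_lt (by simpa using this) h2
    have h := hw fun a => Q.eval (a : K)
    rw [← Lagrange.eq_interpolate hinj hdeg] at h
    simpa [hQe] using h
  have h3 : (n : 𝓞 K) * P.eval ((M : 𝓞 K) * t) -
      ∑ a ∈ S, (w a : 𝓞 K) * P.eval ((M : 𝓞 K) * a) =
      n * (P.eval ((M : 𝓞 K) * t) - L.eval ((M : 𝓞 K) * t)) -
        ∑ a ∈ S, (w a : 𝓞 K) * (P.eval ((M : 𝓞 K) * a) - L.eval ((M : 𝓞 K) * a)) := by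
    simp only [mul_sub, Finset.sum_sub_distrib, hL]
    ring
  rw [h3]
  exact dvd_sub (Dvd.dvd.mul_left (hP t) _) (Finset.dvd_sum fun a _ => Dvd.dvd.mul_left (hP a) _)

/-- Roots of a monic polynomial with polynomial coefficients grow polynomially. -/
theorem exists_house_root_le {K : Type*} [Field K] [NumberField K] {h : (𝓞 K)[X][X]}
    (hm : h.Monic) {e : ℕ} (he : ∀ j, (h.coeff j).natDegree ≤ e) :
    ∃ C : ℝ, 0 ≤ C ∧ ∀ x : ℕ, 1 ≤ x → ∀ y : 𝓞 K, (h.map (evalRingHom (x : 𝓞 K))).eval y = 0 →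
      house (y : K) ≤ C * (x : ℝ) ^ e := by
  let D : ℝ := ∑ j ∈ Finset.range h.natDegree, ∑ i ∈ Finset.range (e + 1),
    house (((h.coeff j).coeff i : 𝓞 K) : K)
  have hD : 0 ≤ D := Finset.sum_nonneg fun _ _ => Finset.sum_nonneg fun _ _ => house_nonneg _
  refine ⟨D + 1, by positivity, fun x hx y hy => ?_⟩
  have hx1 : (1 : ℝ) ≤ x := by exact_mod_cast hx
  rw [house, pi_norm_le_iff_of_nonneg (by positivity)]
  intro σ
  change ‖σ (y : K)‖ ≤ _
  let τ : 𝓞 K →+* ℂ := σ.comp (algebraMap (𝓞 K) K)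
  let p : ℂ[X] := (h.map (evalRingHom (x : 𝓞 K))).map τ
  have hpm : p.Monic := (hm.map _).map _
  have hroot : p.IsRoot (τ y) := by
    simp only [p, IsRoot, eval_map_apply, hy, map_zero]
  have hdeg : p.natDegree = h.natDegree := by
    simp only [p]
    rw [(hm.map _).natDegree_map, hm.natDegree_map]
  have hb := hroot.norm_lt_cauchyBound hpm.ne_zero
  have hcoef : ∀ j ∈ Finset.range h.natDegree, ‖p.coeff j‖ ≤ D * (x : ℝ) ^ e := fun j hj => by
    have h1 : p.coeff j = ∑ i ∈ Finset.range (e + 1), τ ((h.coeff j).coeff i) * (x : ℂ) ^ i := by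
      simp only [p, coeff_map, coe_evalRingHom]
      rw [eval_eq_sum_range' (Nat.lt_succ_of_le (he j))]
      simp
    rw [h1]
    refine (norm_sum_le _ _).trans ?_
    have h2 : ∀ i ∈ Finset.range (e + 1), ‖τ ((h.coeff j).coeff i) * (x : ℂ) ^ i‖ ≤
        house (((h.coeff j).coeff i : 𝓞 K) : K) * (x : ℝ) ^ e := fun i hi => by
      rw [norm_mul, norm_pow, Complex.norm_natCast]
      refine mul_le_mul (norm_embedding_le_house _ σ) ?_ (by positivity) (house_nonneg _)
      exact pow_le_pow_right₀ hx1 (Nat.lt_succ_iff.1 (Finset.mem_range.1 hi))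
    refine (Finset.sum_le_sum h2).trans ?_
    rw [← Finset.sum_mul]
    refine mul_le_mul_of_nonneg_right ?_ (by positivity)
    exact Finset.single_le_sum
      (f := fun j => ∑ i ∈ Finset.range (e + 1), house (((h.coeff j).coeff i : 𝓞 K) : K))
      (fun _ _ => Finset.sum_nonneg fun _ _ => house_nonneg _) hj
  have hcb : (p.cauchyBound : ℝ) ≤ D * (x : ℝ) ^ e + 1 := by
    rw [cauchyBound, hpm.leadingCoeff, nnnorm_one, div_one, NNReal.coe_add, NNReal.coe_one, hdeg]
    have : (Finset.range h.natDegree).sup (fun j => ‖p.coeff j‖₊) ≤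
        (⟨D * (x : ℝ) ^ e, by positivity⟩ : NNReal) :=
      Finset.sup_le fun j hj => by exact_mod_cast hcoef j hj
    gcongr
    exact_mod_cast this
  calc ‖σ (y : K)‖ ≤ D * (x : ℝ) ^ e + 1 := le_trans (NNReal.coe_le_coe.2 hb.le) hcb
    _ ≤ (D + 1) * (x : ℝ) ^ e := by nlinarith [one_le_pow₀ hx1 (n := e)]

/-- Evaluating at `z` a bivariate polynomial recentred at `x`. -/
theorem eval_eval_map_comp_X_add_C {O : Type*} [CommRing O] (h : O[X][X]) (x z : O) (P : O[X]) :
    ((h.map (compRingHom (X + C x))).eval P).eval z =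
      (h.map (evalRingHom (x + z))).eval (P.eval z) := by
  have : (evalRingHom z).comp (compRingHom (X + C x)) = evalRingHom (x + z) := by
    ext <;> simp [add_comm]
  rw [← coe_evalRingHom z, ← eval₂_hom, ← eval_map, Polynomial.map_map, this, coe_evalRingHom]

/-- On a sparse enough progression `x₀ + m ^ κ * a`, integral roots in a fixed simple residue class
modulo `m` are interpolated by a polynomial of bounded degree. -/
theorem eventually_eq_eval_interpolate {K : Type*} [Field K] [NumberField K] {h : (𝓞 K)[X][X]}
    (hm : h.Monic) {e : ℕ} (he : ∀ j, (h.coeff j).natDegree ≤ e) {x₀ m : ℕ} (hm2 : 2 ≤ m)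
    (hx₀ : 1 ≤ x₀)
    (hcop : ∀ x : ℕ, (m : 𝓞 K) ∣ x - x₀ → ∀ y, (m : 𝓞 K) ∣ (h.map (evalRingHom (x : 𝓞 K))).eval y →
      IsCoprime (m : 𝓞 K) ((h.map (evalRingHom (x : 𝓞 K))).derivative.eval y))
    {S : Finset ℕ} (hS : S.card = e + 1) (t : ℕ) :
    ∀ᶠ κ in Filter.atTop, ∀ (y : ℕ → 𝓞 K) (y₀ : 𝓞 K),
      (∀ a ∈ insert t S, (h.map (evalRingHom ((x₀ + m ^ κ * a : ℕ) : 𝓞 K))).eval (y a) = 0) →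
      (∀ a ∈ insert t S, (m : 𝓞 K) ∣ y a - y₀) →
      (y t : K) = (Lagrange.interpolate S (fun a : ℕ => (a : K)) (fun a => (y a : K))).eval (t : K) := by
  obtain ⟨n, w, hn, hw⟩ := exists_int_mul_eval_interpolate K S t
  obtain ⟨C₀, hC₀, hC⟩ := exists_house_root_le hm he
  let D : ℝ := |(n : ℝ)| * (C₀ * (x₀ + t : ℝ) ^ e) + ∑ a ∈ S, |(w a : ℝ)| * (C₀ * (x₀ + a : ℝ) ^ e)
  have hlarge : ∀ᶠ κ in Filter.atTop, D < (m : ℝ) ^ κ :=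
    (tendsto_pow_atTop_atTop_of_one_lt (by exact_mod_cast hm2)).eventually_gt_atTop D
  filter_upwards [hlarge, Filter.eventually_ge_atTop 1] with κ hκ hκ1 y y₀ hy hyy
  set M := m ^ κ with hM
  have hM1 : 1 ≤ M := Nat.one_le_pow _ _ (by omega)
  have hmM : (m : 𝓞 K) ∣ (M : 𝓞 K) := by
    rw [hM, Nat.cast_pow]; exact dvd_pow_self _ (by omega)
  let F : (𝓞 K)[X][X] := h.map (compRingHom (X + C (x₀ : 𝓞 K)))
  let I : Ideal (𝓞 K)[X] := Ideal.span {C (m : 𝓞 K), X}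
  have hI : ∀ z : 𝓞 K, (m : 𝓞 K) ∣ z → I ≤ (Ideal.span {(m : 𝓞 K)}).comap (evalRingHom z) := by
    intro z hz
    refine Ideal.span_le.2 ?_
    rintro p (rfl | rfl)
    · simp
    · simpa [Ideal.mem_span_singleton] using hz
  have hI0 : ∀ p : (𝓞 K)[X], (m : 𝓞 K) ∣ p.eval 0 → p ∈ I := by
    intro p hp
    obtain ⟨c, hc⟩ := hp
    have := modByMonic_add_div p (X : (𝓞 K)[X])
    rw [modByMonic_X, hc, C_mul] at this
    rw [← this]
    exact I.add_mem (I.mul_mem_right _ (Ideal.subset_span (by simp)))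
      (I.mul_mem_right _ (Ideal.subset_span (by simp)))
  have hroot0 : (m : 𝓞 K) ∣ (h.map (evalRingHom (x₀ : 𝓞 K))).eval y₀ := by
    obtain ⟨c, hc⟩ := F.evalSubFactor (C (y t)) (C y₀)
    have h1 : (m : 𝓞 K) ∣ (F.eval (C (y t))).eval 0 := by
      have h2 : ((M : 𝓞 K) * t) - 0 ∣ (F.eval (C (y t))).eval ((M : 𝓞 K) * t) -
          (F.eval (C (y t))).eval 0 := sub_dvd_eval_sub _ _ _
      have h3 := hy t (Finset.mem_insert_self _ _)
      rw [eval_eval_map_comp_X_add_C, eval_C] at h2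
      push_cast at h3
      rw [h3, zero_sub, dvd_neg, sub_zero] at h2
      exact (Dvd.dvd.mul_right hmM _).trans h2
    have h4 := congrArg (eval 0) hc
    have h5 := hyy t (Finset.mem_insert_self _ _)
    have h6 : (F.eval (C y₀)).eval 0 =
        (F.eval (C (y t))).eval 0 - c.eval 0 * (y t - y₀) := by
      simp only [eval_sub, eval_mul, eval_C] at h4
      rw [← h4]; ring
    have h7 : (m : 𝓞 K) ∣ (F.eval (C y₀)).eval 0 := by
      rw [h6]; exact dvd_sub h1 (Dvd.dvd.mul_left h5 _)
    rwa [eval_eval_map_comp_X_add_C, eval_C, add_zero] at h7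
  obtain ⟨u, u', hu⟩ := hcop x₀ (by simp) y₀ hroot0
  obtain ⟨P, hP, hFP⟩ := exists_eval_mem_pow_of_eval_mem (I := I) (F := F) (a := C y₀) (u := C u')
    (hI0 _ (by rw [eval_eval_map_comp_X_add_C, eval_C, add_zero]; exact hroot0))
    (hI0 _ (by
      rw [derivative_map, eval_sub, eval_mul, eval_C, eval_eval_map_comp_X_add_C, eval_C, add_zero,
        ← derivative_map, eval_one]
      exact ⟨-u, by linear_combination hu⟩)) (κ * (e + 1))
  have happrox : ∀ a ∈ insert t S, (M : 𝓞 K) ^ (e + 1) ∣ y a - P.eval ((M : 𝓞 K) * a) := by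
    intro a ha
    have hIa := hI ((M : 𝓞 K) * a) (Dvd.dvd.mul_right hmM _)
    have h1 : (m : 𝓞 K) ∣ P.eval ((M : 𝓞 K) * a) - y₀ := by
      have := hIa hP
      simpa [Ideal.mem_span_singleton] using this
    have h2 : (m : 𝓞 K) ^ (κ * (e + 1)) ∣
        (h.map (evalRingHom ((x₀ + m ^ κ * a : ℕ) : 𝓞 K))).eval (P.eval ((M : 𝓞 K) * a)) := by
      have h3 : F.eval P ∈ I ^ (κ * (e + 1)) := Ideal.pow_le_pow_right (Nat.le_succ _) hFP
      have h4 := (Ideal.pow_right_mono hIa _).trans (Ideal.le_comap_pow _ _) h3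
      rw [Ideal.mem_comap, Ideal.span_singleton_pow, Ideal.mem_span_singleton, coe_evalRingHom,
        eval_eval_map_comp_X_add_C] at h4
      simpa [hM] using h4
    have h5 := pow_dvd_sub_of_eval_eq_zero (m := (m : 𝓞 K)) (hy a ha) h2 (by
        have := dvd_sub (hyy a ha) h1
        simpa using this)
      (hcop _ (by
        push_cast; rw [add_sub_cancel_left]; exact Dvd.dvd.mul_right hmM _) _ (by
        rw [hy a ha]; exact dvd_zero _))
    rw [hM, Nat.cast_pow, ← pow_mul]
    simpa [hM] using h5
  let Δ : 𝓞 K := n * y t - ∑ a ∈ S, (w a : 𝓞 K) * y a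
  have hdvd : (M : 𝓞 K) ^ (e + 1) ∣ Δ := by
    have h1 := pow_dvd_interpolation_defect hw P M
    rw [hS] at h1
    have h2 : Δ = (n * P.eval ((M : 𝓞 K) * t) - ∑ a ∈ S, (w a : 𝓞 K) * P.eval ((M : 𝓞 K) * a)) +
        (n * (y t - P.eval ((M : 𝓞 K) * t)) -
          ∑ a ∈ S, (w a : 𝓞 K) * (y a - P.eval ((M : 𝓞 K) * a))) := by
      simp only [Δ, mul_sub, Finset.sum_sub_distrib]
      ring
    rw [h2]
    refine dvd_add h1 (dvd_sub (Dvd.dvd.mul_left (happrox t (Finset.mem_insert_self _ _)) _) ?_)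
    exact Finset.dvd_sum fun a ha =>
      Dvd.dvd.mul_left (happrox a (Finset.mem_insert_of_mem ha)) _
  have hsize : ∀ a ∈ insert t S, house (y a : K) ≤ (C₀ * (x₀ + a : ℝ) ^ e) * (M : ℝ) ^ e := by
    intro a ha
    refine (hC _ (by omega) _ (hy a ha)).trans ?_
    rw [mul_assoc, ← mul_pow]
    refine mul_le_mul_of_nonneg_left ?_ hC₀
    refine pow_le_pow_left₀ (by positivity) ?_ _
    have h1 : (1 : ℝ) ≤ M := by exact_mod_cast hM1
    have h2 : (0 : ℝ) ≤ x₀ := by positivity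
    push_cast
    nlinarith
  have hneg : ∀ α : K, house (-α) = house α := fun α => by simp [house]
  have hΔsize : house (Δ : K) ≤ D * (M : ℝ) ^ e := by
    have hint : ∀ (i : ℤ) (z : K), house ((i : K) * z) ≤ |(i : ℝ)| * house z := fun i z => by
      refine (house_mul_le _ _).trans ?_
      rw [house_intCast, Int.cast_abs]
    have h1 : (Δ : K) = n * (y t : K) + -∑ a ∈ S, (w a : K) * (y a : K) := by
      simp [Δ, sub_eq_add_neg]
    rw [h1, add_mul, Finset.sum_mul]
    refine (house_add_le _ _).trans (add_le_add ?_ ?_)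
    · rw [mul_assoc]
      exact (hint _ _).trans (mul_le_mul_of_nonneg_left
        (hsize t (Finset.mem_insert_self _ _)) (abs_nonneg _))
    · rw [hneg]
      refine (house_sum_le_sum_house _ _).trans (Finset.sum_le_sum fun a ha => ?_)
      rw [mul_assoc]
      exact (hint _ _).trans (mul_le_mul_of_nonneg_left
        (hsize a (Finset.mem_insert_of_mem ha)) (abs_nonneg _))
  have hΔ : Δ = 0 := by
    by_contra hne
    obtain ⟨β, hβ⟩ := hdvd
    have hβ0 : (β : K) ≠ 0 := fun h0 => hne (by
      have : β = 0 := RingOfIntegers.coe_injective (by simpa using h0)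
      rw [hβ, this, mul_zero])
    have h1 : (Δ : K) = ((M ^ (e + 1) : ℕ) : K) * (β : K) := by
      rw [hβ]; simp
    rw [h1, house_nat_mul] at hΔsize
    have h2 := one_le_house_of_isIntegral (RingOfIntegers.isIntegral_coe β) hβ0
    have h3 : (M : ℝ) ^ e * M ≤ (M : ℝ) ^ e * D := by
      calc (M : ℝ) ^ e * M = ((M ^ (e + 1) : ℕ) : ℝ) * 1 := by push_cast; ring
        _ ≤ ((M ^ (e + 1) : ℕ) : ℝ) * house (β : K) := by gcongr
        _ ≤ _ := by linarith
    have h4 : (M : ℝ) ≤ D := le_of_mul_le_mul_left h3 (by positivity)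
    have h5 : (M : ℝ) = (m : ℝ) ^ κ := by simp [hM]
    linarith
  have h1 : (n : K) * (y t : K) = ∑ a ∈ S, (w a : K) * (y a : K) := by
    have := congrArg (algebraMap (𝓞 K) K) hΔ
    simpa [Δ, sub_eq_zero] using this
  rw [← hw] at h1
  exact mul_left_cancel₀ (by exact_mod_cast hn) h1

/-- A nonzero polynomial over a domain of characteristic zero has no large natural roots. -/
theorem exists_nat_forall_ge_eval_ne_zero {R : Type*} [CommRing R] [IsDomain R] [CharZero R]
    {p : R[X]} (hp : p ≠ 0) : ∃ N : ℕ, ∀ x : ℕ, N ≤ x → p.eval (x : R) ≠ 0 := by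
  have hfin : {x : ℕ | p.IsRoot (x : R)}.Finite :=
    (finite_setOfPred_isRoot hp).preimage Nat.cast_injective.injOn
  obtain ⟨N, hN⟩ := hfin.bddAbove
  exact ⟨N + 1, fun x hx h0 => absurd (hN h0) (by omega)⟩

/-- A monic polynomial `h` over a ring of integers with nonzero discriminant and no polynomial root
has arbitrarily large natural specializations without integral roots. -/
theorem exists_nat_forall_eval_ne_zero_of_integral {K : Type*} [Field K] [NumberField K]
    {h A B : (𝓞 K)[X][X]} {δ : (𝓞 K)[X]} (hm : h.Monic) (hδ : δ ≠ 0)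
    (hAB : A * h + B * derivative h = C δ)
    (hroot : ∀ r : K[X], (h.map (mapRingHom (algebraMap (𝓞 K) K))).eval r ≠ 0) (N : ℕ) :
    ∃ x : ℕ, N ≤ x ∧ ∀ y : 𝓞 K, (h.map (evalRingHom (x : 𝓞 K))).eval y ≠ 0 := by
  classical
  obtain ⟨N₀, hN₀⟩ := exists_nat_forall_ge_eval_ne_zero hδ
  obtain ⟨x₀, hNx, hx₀⟩ : ∃ x : ℕ, N + 1 ≤ x ∧ δ.eval (x : 𝓞 K) ≠ 0 :=
    ⟨max N₀ (N + 1), le_max_right _ _, hN₀ _ (le_max_left _ _)⟩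
  obtain ⟨m, hm2, hmδ⟩ : ∃ m : ℕ, 2 ≤ m ∧ IsCoprime (m : 𝓞 K) (δ.eval (x₀ : 𝓞 K)) := by
    have h0 : Ideal.absNorm (Ideal.span {δ.eval (x₀ : 𝓞 K)}) ≠ 0 := by
      simpa [Ideal.absNorm_eq_zero_iff] using hx₀
    obtain ⟨c, hc⟩ := Ideal.mem_span_singleton.1
      (Ideal.absNorm_mem (Ideal.span {δ.eval (x₀ : 𝓞 K)}))
    refine ⟨Ideal.absNorm (Ideal.span {δ.eval (x₀ : 𝓞 K)}) + 1, by omega, 1, -c, ?_⟩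
    push_cast
    rw [hc]; ring
  have hcop : ∀ x : ℕ, (m : 𝓞 K) ∣ x - x₀ → ∀ y,
      (m : 𝓞 K) ∣ (h.map (evalRingHom (x : 𝓞 K))).eval y →
      IsCoprime (m : 𝓞 K) ((h.map (evalRingHom (x : 𝓞 K))).derivative.eval y) := by
    intro x hx y hy
    have h1 := congrArg (fun p : (𝓞 K)[X][X] => (p.map (evalRingHom (x : 𝓞 K))).eval y) hAB
    simp only [Polynomial.map_add, Polynomial.map_mul, eval_add, eval_mul, map_C, eval_C,
      coe_evalRingHom, ← derivative_map] at h1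
    obtain ⟨c, hc⟩ := hx.trans (sub_dvd_eval_sub (x : 𝓞 K) x₀ δ)
    obtain ⟨d, hd⟩ := hy
    obtain ⟨u, v, huv⟩ := hmδ
    rw [hd] at h1
    refine ⟨u - v * c + v * (A.map (evalRingHom (x : 𝓞 K))).eval y * d,
      v * (B.map (evalRingHom (x : 𝓞 K))).eval y, ?_⟩
    linear_combination huv + v * h1 + v * hc
  let e := h.support.sup fun j => (h.coeff j).natDegree
  have he : ∀ j, (h.coeff j).natDegree ≤ e := fun j => by
    by_cases hj : j ∈ h.support
    · exact Finset.le_sup (f := fun j => (h.coeff j).natDegree) hj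
    · simp [notMem_support_iff.1 hj]
  let E := e + h.natDegree * (e + 1)
  let J : Ideal (𝓞 K) := Ideal.span {(m : 𝓞 K)}
  have hJ : J ≠ ⊥ := by
    simp only [J, ne_eq, Ideal.span_singleton_eq_bot, Nat.cast_eq_zero]; omega
  have : Finite (𝓞 K ⧸ J) := Ideal.finiteQuotientOfFreeOfNeBot J hJ
  have := Fintype.ofFinite (𝓞 K ⧸ J)
  let T := Fintype.card (𝓞 K ⧸ J) * (E + e + 1) + 1
  have hev : ∀ᶠ κ in Filter.atTop, ∀ S ∈ (Finset.range T).powersetCard (e + 1),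
      ∀ t ∈ Finset.range T, ∀ (y : ℕ → 𝓞 K) (y₀ : 𝓞 K),
      (∀ a ∈ insert t S, (h.map (evalRingHom ((x₀ + m ^ κ * a : ℕ) : 𝓞 K))).eval (y a) = 0) →
      (∀ a ∈ insert t S, (m : 𝓞 K) ∣ y a - y₀) →
      (y t : K) =
        (Lagrange.interpolate S (fun a : ℕ => (a : K)) (fun a => (y a : K))).eval (t : K) := by
    rw [Filter.eventually_all_finset]
    intro S hS
    rw [Filter.eventually_all_finset]
    intro t _
    exact eventually_eq_eval_interpolate hm he hm2 (by omega) hcop (Finset.mem_powersetCard.1 hS).2 t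
  obtain ⟨κ, hκ⟩ := hev.exists
  by_contra! hcon
  choose! y hy using hcon
  have hy' : ∀ a : ℕ, (h.map (evalRingHom ((x₀ + m ^ κ * a : ℕ) : 𝓞 K))).eval
      (y (x₀ + m ^ κ * a)) = 0 := fun a => hy _ (by omega)
  set z : ℕ → 𝓞 K := fun a => y (x₀ + m ^ κ * a)
  obtain ⟨c, -, hc⟩ := Finset.exists_lt_card_fiber_of_mul_lt_card_of_maps_to
    (s := Finset.range T) (t := (Finset.univ : Finset (𝓞 K ⧸ J)))
    (f := fun a => Ideal.Quotient.mk J (z a)) (n := E + e + 1) (fun _ _ => Finset.mem_univ _)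
    (by simp [T])
  set Z := (Finset.range T).filter fun a => Ideal.Quotient.mk J (z a) = c
  obtain ⟨y₀, rfl⟩ := Ideal.Quotient.mk_surjective c
  have hZ : ∀ a ∈ Z, (m : 𝓞 K) ∣ z a - y₀ := fun a ha => by
    have := (Finset.mem_filter.1 ha).2
    rwa [Ideal.Quotient.mk_eq_mk_iff_sub_mem, Ideal.mem_span_singleton] at this
  obtain ⟨S, hSZ, hS⟩ := Finset.exists_subset_card_eq (show e + 1 ≤ Z.card by omega)
  set q := Lagrange.interpolate S (fun a : ℕ => (a : K)) (fun a => (z a : K))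
  have hzq : ∀ t ∈ Z, (z t : K) = q.eval (t : K) := fun t ht => by
    refine hκ S (Finset.mem_powersetCard.2 ⟨hSZ.trans (Finset.filter_subset _ _), hS⟩) t
      (Finset.filter_subset _ _ ht) z y₀ (fun a _ => hy' a) (fun a ha => hZ a ?_)
    rcases Finset.mem_insert.1 ha with rfl | ha
    exacts [ht, hSZ ha]
  have hqdeg : q.natDegree ≤ e + 1 := by
    have : q.degree < S.card := Lagrange.degree_interpolate_lt _
      fun a _ b _ h => by simpa using h
    rw [hS] at this
    exact natDegree_le_of_degree_le this.le
  have hM0 : ((m ^ κ : ℕ) : K) ≠ 0 := by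
    have : m ≠ 0 := by omega
    exact_mod_cast pow_ne_zero κ this
  let ℓ : K[X] := C ((m ^ κ : ℕ) : K) * X + C (x₀ : K)
  have hℓ : ℓ.natDegree ≤ 1 := natDegree_linear_le
  let hK := h.map (mapRingHom (algebraMap (𝓞 K) K))
  let G : K[X] := (hK.map (compRingHom ℓ)).eval q
  have hGeval : ∀ t ∈ Z, G.eval (t : K) = 0 := fun t ht => by
    have h1 : ((evalRingHom (t : K)).comp (compRingHom ℓ)).comp (mapRingHom (algebraMap (𝓞 K) K)) =
        (algebraMap (𝓞 K) K).comp (evalRingHom ((x₀ + m ^ κ * t : ℕ) : 𝓞 K)) := by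
      ext <;> simp [ℓ, add_comm]
    have h2 := congrArg (algebraMap (𝓞 K) K) (hy' t)
    rw [map_zero, ← eval_map_apply, Polynomial.map_map, ← h1] at h2
    rw [← coe_evalRingHom, ← eval_map_apply, Polynomial.map_map, Polynomial.map_map,
      coe_evalRingHom, ← hzq t ht]
    exact h2
  have hGdeg : G.natDegree ≤ E := by
    simp only [G, eval_eq_sum_range, coeff_map, hK]
    refine natDegree_sum_le_of_forall_le _ _ fun j hj => ?_
    refine natDegree_mul_le.trans (Nat.add_le_add ?_ ?_)
    · refine natDegree_comp_le.trans ?_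
      calc _ ≤ e * 1 := Nat.mul_le_mul (natDegree_map_le.trans (he j)) hℓ
        _ = e := mul_one e
    · refine natDegree_pow_le.trans (Nat.mul_le_mul ?_ hqdeg)
      have h1 : (hK.map (compRingHom ℓ)).natDegree ≤ h.natDegree :=
        natDegree_map_le.trans natDegree_map_le
      have h2 := Finset.mem_range.1 hj
      simp only [hK] at h1
      omega
  have hG : G = 0 := by
    refine eq_zero_of_natDegree_lt_card_of_eval_eq_zero' G (Z.image fun a : ℕ => (a : K)) ?_ ?_
    · intro a ha
      obtain ⟨t, ht, rfl⟩ := Finset.mem_image.1 ha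
      exact hGeval t ht
    · rw [Finset.card_image_of_injective _ Nat.cast_injective]
      omega
  let ℓ' : K[X] := C (((m ^ κ : ℕ) : K)⁻¹) * (X - C (x₀ : K))
  have hℓℓ' : ℓ.comp ℓ' = X := by
    simp only [ℓ, ℓ', add_comp, mul_comp, C_comp, X_comp, ← mul_assoc, ← C_mul]
    rw [mul_inv_cancel₀ hM0]
    simp
  apply hroot (q.comp ℓ')
  have h1 : (compRingHom ℓ').comp (compRingHom ℓ) = RingHom.id K[X] := by
    ext <;> simp [hℓℓ']
  have h2 := congrArg (compRingHom ℓ') hG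
  rw [map_zero, ← eval_map_apply, Polynomial.map_map, h1, Polynomial.map_id] at h2
  simpa using h2

theorem separable_map_fractionRing_prod {R : Type*} [CommRing R] [IsDomain R]
    [IsIntegrallyClosed R] [CharZero R] (s : Finset R[X]) (hm : ∀ h ∈ s, h.Monic)
    (hi : ∀ h ∈ s, Irreducible h) :
    ((∏ h ∈ s, h).map (algebraMap R (FractionRing R))).Separable := by
  have hinj : Function.Injective (algebraMap R (FractionRing R)) :=
    IsFractionRing.injective R (FractionRing R)
  have : CharZero (FractionRing R) := charZero_of_injective_algebraMap hinj
  have hirr : ∀ h ∈ s, Irreducible (h.map (algebraMap R (FractionRing R))) := fun h hh =>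
    ((hm h hh).irreducible_iff_irreducible_map_fraction_map).1 (hi h hh)
  rw [Polynomial.map_prod]
  refine separable_prod' (fun x hx y hy hxy => ?_) fun x hx => (hirr x hx).separable
  refine ((hirr x hx).coprime_iff_not_dvd).2 fun hdvd => hxy (map_injective _ hinj ?_)
  exact eq_of_monic_of_associated ((hm x hx).map _) ((hm y hy).map _)
    ((hirr x hx).associated_of_dvd (hirr y hy) hdvd)

theorem derivative_scaleRoots {R : Type*} [CommRing R] [IsDomain R] [CharZero R] (p : R[X])
    (r : R) : derivative (p.scaleRoots r) = (derivative p).scaleRoots r := by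
  ext n
  rw [coeff_derivative, coeff_scaleRoots, coeff_scaleRoots, coeff_derivative,
    natDegree_derivative]
  rw [show p.natDegree - (n + 1) = p.natDegree - 1 - n by omega]
  ring

theorem Polynomial.Separable.scaleRoots {F : Type*} [Field F] [CharZero F] {p : F[X]}
    (hp : p.Separable) {r : F} (hr : r ≠ 0) : (p.scaleRoots r).Separable := by
  have h0 : resultant p (derivative p) ≠ 0 := resultant_ne_zero _ _ hp
  have h1 : resultant (p.scaleRoots r) (derivative (p.scaleRoots r)) ≠ 0 := by
    rw [derivative_scaleRoots, resultant_scaleRoots]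
    exact mul_ne_zero (pow_ne_zero _ hr) h0
  by_contra hc
  refine h1 (resultant_eq_zero_iff.2 ⟨Or.inl ?_, hc⟩)
  rw [← leadingCoeff_ne_zero, ← coeff_natDegree, natDegree_scaleRoots, coeff_scaleRoots_natDegree]
  exact leadingCoeff_ne_zero.2 hp.ne_zero

theorem exists_bezout_derivative_of_separable_map {R F : Type*} [CommRing R] [Field F]
    [CharZero F] {φ : R →+* F} (hφ : Function.Injective φ) {h : R[X]} (hd : h.natDegree ≠ 0)
    (hs : (h.map φ).Separable) :
    ∃ (A B : R[X]) (δ : R), δ ≠ 0 ∧ A * h + B * derivative h = C δ := by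
  obtain ⟨p, q, -, -, hpq⟩ := exists_mul_add_mul_eq_C_resultant h (derivative h) le_rfl le_rfl
    (Or.inl hd)
  refine ⟨p, q, _, fun h0 => ?_, by rw [← hpq]; ring⟩
  have h1 := congrArg φ h0
  rw [map_zero, ← resultant_map_map, ← derivative_map] at h1
  have h2 := resultant_ne_zero _ _ hs
  rw [natDegree_map_eq_of_injective hφ, derivative_map, natDegree_map_eq_of_injective hφ] at h2
  rw [derivative_map] at h1
  exact h2 h1

/-- A monic bivariate polynomial becomes integral after scaling the second variable. -/
theorem exists_scaleRoots_eq_map {K : Type*} [Field K] [NumberField K] {H : K[X][X]}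
    (hm : H.Monic) : ∃ (c : 𝓞 K) (h : (𝓞 K)[X][X]), c ≠ 0 ∧ h.Monic ∧
      h.map (mapRingHom (algebraMap (𝓞 K) K)) = H.scaleRoots (C (algebraMap (𝓞 K) K c)) := by
  let _ : Algebra (𝓞 K)[X] K[X] := Polynomial.algebra (𝓞 K) K
  have := Polynomial.isLocalization (nonZeroDivisors (𝓞 K)) K
  set M := (nonZeroDivisors (𝓞 K)).map (C : 𝓞 K →+* (𝓞 K)[X])
  have h1 := IsLocalization.scaleRoots_commonDenom_mem_lifts M H
    (by rw [hm.leadingCoeff]; exact one_mem _)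
  obtain ⟨h, h2, -, h3⟩ := lifts_and_natDegree_eq_and_monic h1 (by rwa [monic_scaleRoots_iff])
  obtain ⟨c, hc, hc'⟩ := (IsLocalization.commonDenom M H.support H.coeff).2
  refine ⟨c, h, nonZeroDivisors.ne_zero hc, h3, ?_⟩
  have e : algebraMap (𝓞 K)[X] K[X] = mapRingHom (algebraMap (𝓞 K) K) := rfl
  rw [← hc', e] at h2
  simpa using h2

/-- For finitely many monic irreducible bivariate polynomials of degree at least two over a number
field, there are arbitrarily large natural specializations without roots. -/
theorem NumberField.exists_nat_forall_eval_ne_zero {K : Type*} [Field K] [NumberField K]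
    (s : Finset K[X][X]) (hm : ∀ h ∈ s, h.Monic) (hi : ∀ h ∈ s, Irreducible h)
    (hd : ∀ h ∈ s, 2 ≤ h.natDegree) (N : ℕ) :
    ∃ x : ℕ, N ≤ x ∧ ∀ h ∈ s, ∀ y : K, (h.map (evalRingHom (x : K))).eval y ≠ 0 := by
  set H : K[X][X] := ∏ h ∈ s, h with hH
  have hHm : H.Monic := monic_prod_of_monic _ _ hm
  rcases s.eq_empty_or_nonempty with rfl | ⟨h₀, hh₀⟩
  · exact ⟨N, le_rfl, by simp⟩
  have hHr : ∀ r : K[X], H.eval r ≠ 0 := by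
    intro r
    rw [hH, eval_prod, Finset.prod_ne_zero_iff]
    intro h hh h0
    have h1 : X - C r ∣ h := dvd_iff_isRoot.2 h0
    have h2 := eq_of_monic_of_associated (monic_X_sub_C r) (hm h hh)
      (((monic_X_sub_C r).irreducible_of_degree_eq_one (degree_X_sub_C r)).associated_of_dvd
        (hi h hh) h1)
    have h3 := hd h hh
    rw [← h2, natDegree_X_sub_C] at h3
    omega
  have hHd : H.natDegree ≠ 0 := by
    rw [hH, natDegree_prod_of_monic _ _ hm]
    have := Finset.single_le_sum (f := fun h : K[X][X] => h.natDegree) (fun _ _ => Nat.zero_le _) hh₀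
    have := hd h₀ hh₀
    grind
  obtain ⟨c, h, hc, hhm, hh⟩ := exists_scaleRoots_eq_map hHm
  have hcK : algebraMap (𝓞 K) K c ≠ 0 := by simpa using hc
  let ψ : (𝓞 K)[X] →+* K[X] := mapRingHom (algebraMap (𝓞 K) K)
  have hψ : Function.Injective ψ := map_injective _ (FaithfulSMul.algebraMap_injective (𝓞 K) K)
  let φ : (𝓞 K)[X] →+* FractionRing K[X] := (algebraMap K[X] (FractionRing K[X])).comp ψ
  have hφ : Function.Injective φ :=
    (IsFractionRing.injective K[X] (FractionRing K[X])).comp hψ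
  have : CharZero (FractionRing K[X]) :=
    charZero_of_injective_algebraMap (IsFractionRing.injective K[X] (FractionRing K[X]))
  have hsep : (h.map φ).Separable := by
    rw [← Polynomial.map_map, hh, map_scaleRoots _ _ _ (by simp [hHm.leadingCoeff])]
    exact (separable_map_fractionRing_prod s hm hi).scaleRoots (by simpa using hcK)
  obtain ⟨A, B, δ, hδ, hAB⟩ := exists_bezout_derivative_of_separable_map hφ
    (by rwa [← natDegree_map_eq_of_injective hψ, hh, natDegree_scaleRoots]) hsep
  obtain ⟨x, hx, hxy⟩ := exists_nat_forall_eval_ne_zero_of_integral hhm hδ hAB (fun r hr => by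
    rw [hh] at hr
    have e : r = C (algebraMap (𝓞 K) K c) * (C ((algebraMap (𝓞 K) K c)⁻¹) * r) := by
      rw [← mul_assoc, ← C_mul, mul_inv_cancel₀ hcK, C_1, one_mul]
    rw [e, scaleRoots_eval_mul] at hr
    exact hHr _ ((mul_eq_zero.1 hr).resolve_left (pow_ne_zero _ (by simpa using hcK)))) N
  refine ⟨x, hx, fun g hg y hy => ?_⟩
  have h1 : (H.map (evalRingHom (x : K))).eval y = 0 := by
    rw [hH, Polynomial.map_prod, eval_prod]
    exact Finset.prod_eq_zero hg hy
  have h2 : ((h.map (evalRingHom (x : 𝓞 K))).map (algebraMap (𝓞 K) K)).eval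
      (algebraMap (𝓞 K) K c * y) = 0 := by
    have e : (algebraMap (𝓞 K) K).comp (evalRingHom (x : 𝓞 K)) =
        (evalRingHom (x : K)).comp (mapRingHom (algebraMap (𝓞 K) K)) := by
      ext <;> simp
    rw [Polynomial.map_map, e, ← Polynomial.map_map, hh, map_scaleRoots _ _ _
      (by simp [hHm.leadingCoeff])]
    simp only [coe_evalRingHom, eval_C]
    rw [scaleRoots_eval_mul, h1, mul_zero]
  have h3 : IsIntegral (𝓞 K) (algebraMap (𝓞 K) K c * y) :=
    ⟨h.map (evalRingHom (x : 𝓞 K)), hhm.map _, by rw [← eval_map]; exact h2⟩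
  obtain ⟨z, hz⟩ := IsIntegrallyClosed.isIntegral_iff.1 h3
  rw [← hz, eval_map, eval₂_at_apply] at h2
  exact hxy z (by simpa using h2)

/-- A monic polynomial over a domain splits into linear factors over an integral extension
domain. -/
theorem exists_isIntegral_map_eq_prod.{u} {A : Type u} [CommRing A] [IsDomain A] {F : A[X]}
    (hm : F.Monic) :
    ∃ (R : Type u) (_ : CommRing R) (_ : IsDomain R) (_ : Algebra A R),
      Algebra.IsIntegral A R ∧ Function.Injective (algebraMap A R) ∧
      ∃ β : Fin F.natDegree → R, F.map (algebraMap A R) = ∏ i, (X - C (β i)) := by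
  let Ω := AlgebraicClosure (FractionRing A)
  have hinj : Function.Injective (algebraMap A Ω) := by
    rw [IsScalarTower.algebraMap_eq A (FractionRing A) Ω]
    exact (algebraMap (FractionRing A) Ω).injective.comp (IsFractionRing.injective A _)
  have hs := IsAlgClosed.splits (F.map (algebraMap A Ω))
  set l := (F.map (algebraMap A Ω)).roots.toList with hl
  have hcard : F.natDegree = l.length := by
    rw [hl, Multiset.length_toList, ← hs.natDegree_eq_card_roots, hm.natDegree_map]
  have hprod : F.map (algebraMap A Ω) = (l.map fun a => X - C a).prod := by
    rw [hl, ← Multiset.prod_coe, ← Multiset.map_coe, Multiset.coe_toList]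
    exact hs.eq_prod_roots_of_monic (hm.map _)
  have hint : ∀ i : Fin l.length, l[i] ∈ integralClosure A Ω := by
    intro i
    have h1 : l[i] ∈ l := List.getElem_mem _
    generalize l[i] = a at h1 ⊢
    rw [hl, Multiset.mem_toList, mem_roots', IsRoot.def, eval_map] at h1
    exact ⟨F, hm, h1.2⟩
  refine ⟨integralClosure A Ω, inferInstance, inferInstance, inferInstance, inferInstance,
    fun a b hab => hinj (congrArg Subtype.val hab), ?_⟩
  rw [hcard]
  refine ⟨fun i => ⟨l[i], hint i⟩,
    map_injective (algebraMap (integralClosure A Ω) Ω) Subtype.val_injective ?_⟩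
  rw [Polynomial.map_map, ← IsScalarTower.algebraMap_eq]
  refine hprod.trans ?_
  rw [← Fin.prod_univ_fun_getElem, Polynomial.map_prod]
  refine Finset.prod_congr rfl fun i _ => ?_
  rw [Polynomial.map_sub, map_X, map_C]
  rfl

/-- **Hilbert irreducibility** over number fields, for monic polynomials and natural
specializations. -/
theorem NumberField.exists_nat_irreducible_map_evalRingHom {L : Type*} [Field L] [NumberField L]
    {F : L[X][X]} (hm : F.Monic) (hi : Irreducible F) (N : ℕ) :
    ∃ x : ℕ, N ≤ x ∧ Irreducible (F.map (evalRingHom (x : L))) := by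
  classical
  obtain ⟨R, _, _, _, _, hρ, β, hβ⟩ := exists_isIntegral_map_eq_prod hm
  let ρ : L[X] →+* R := algebraMap L[X] R
  have : FaithfulSMul L[X] R := (faithfulSMul_iff_algebraMap_injective _ _).2 hρ
  let g : Finset (Fin F.natDegree) → R[X] := fun t => ∏ i ∈ t, (X - C (β i))
  have hg : ∀ t, (g t).Monic := fun t => monic_prod_of_monic _ _ fun i _ => monic_X_sub_C _
  have hgd : ∀ t, (g t).natDegree = t.card := fun t => natDegree_finsetProd_X_sub_C_eq_card _ _
  let T : Finset (Finset (Fin F.natDegree) × ℕ) :=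
    (Finset.univ ×ˢ Finset.range (F.natDegree + 1)).filter fun p => (g p.1).coeff p.2 ∉ ρ.range
  let s : Finset L[X][X] := T.image fun p => minpoly L[X] ((g p.1).coeff p.2)
  have hint : ∀ r : R, IsIntegral L[X] r := fun r => Algebra.IsIntegral.isIntegral r
  obtain ⟨x, hx, hxs⟩ := NumberField.exists_nat_forall_eval_ne_zero s
    (by simp only [s, Finset.forall_mem_image]; exact fun p _ => minpoly.monic (hint _))
    (by
      simp only [s, Finset.forall_mem_image]
      exact fun p _ => (minpoly.prime_of_isIntegrallyClosed (hint _)).irreducible)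
    (by
      simp only [s, Finset.forall_mem_image]
      exact fun p hp => (minpoly.two_le_natDegree_iff (hint _)).2 (Finset.mem_filter.1 hp).2) N
  refine ⟨x, hx, ?_⟩
  have hd : 0 < F.natDegree := hm.natDegree_pos_of_not_isUnit hi.not_isUnit
  have hFx := hm.map (evalRingHom (x : L))
  obtain ⟨Q, hQ, hQx⟩ := Ideal.exists_ideal_over_maximal_of_isIntegral (S := R)
    (RingHom.ker (evalRingHom (x : L)))
    (P_max := RingHom.ker_isMaximal_of_surjective _ fun a => ⟨C a, by simp⟩)
    (by rw [(RingHom.injective_iff_ker_eq_bot _).1 hρ]; exact bot_le)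
  let φ : R →+* R ⧸ Q := Ideal.Quotient.mk Q
  let j : L →+* R ⧸ Q := φ.comp (ρ.comp C)
  have hj : Function.Injective j := j.injective
  have hφρ : φ.comp ρ = j.comp (evalRingHom (x : L)) := by
    ext a
    · simp [j]
    · simp only [RingHom.comp_apply, j, coe_evalRingHom, eval_X]
      rw [← sub_eq_zero, ← map_sub, ← map_sub, Ideal.Quotient.eq_zero_iff_mem]
      have : X - C (x : L) ∈ Q.comap (algebraMap L[X] R) := by
        rw [hQx]; simp [RingHom.mem_ker]
      exact this
  rw [irreducible_of_monic hFx fun h1 => by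
    have := hm.natDegree_map (evalRingHom (x : L)); rw [h1, natDegree_one] at this; omega]
  intro p q hp hq hpq
  have hprod : p.map j * q.map j = 1 * ∏ i, (X - C (φ (β i))) := by
    rw [← Polynomial.map_mul, hpq, Polynomial.map_map, ← hφρ, ← Polynomial.map_map, hβ,
      Polynomial.map_prod, one_mul]
    simp
  obtain ⟨t, u, b, c, -, -, hbc, hpt, -⟩ := mul_eq_mul_prime_prod
    (fun i _ => prime_X_sub_C (φ (β i))) hprod
  have hgφ : (g t).map φ = ∏ i ∈ t, (X - C (φ (β i))) := by simp [g, Polynomial.map_prod]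
  rw [← hgφ] at hpt
  have hb : b = 1 := by
    have hb' : b.Monic := Monic.of_mul_monic_right ((hg t).map φ) (hpt ▸ hp.map j)
    exact hb'.eq_one_of_isUnit (IsUnit.of_mul_eq_one c hbc.symm)
  rw [hb, one_mul] at hpt
  have hpd : p.natDegree = t.card := by
    rw [← hp.natDegree_map j, hpt, (hg t).natDegree_map, hgd]
  have hlift : g t ∈ lifts ρ := by
    rw [lifts_iff_coeff_lifts]
    intro n
    by_contra hn
    by_cases hnd : n ≤ F.natDegree
    swap
    · refine hn ⟨0, ?_⟩
      rw [map_zero, coeff_eq_zero_of_natDegree_lt]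
      have := Finset.card_le_univ t
      rw [Fintype.card_fin] at this
      rw [hgd]; omega
    have hT : (t, n) ∈ T := by
      simp only [T, Finset.mem_filter, Finset.mem_product, Finset.mem_univ, Finset.mem_range,
        true_and]
      exact ⟨by omega, hn⟩
    refine hxs _ (Finset.mem_image_of_mem _ hT) (p.coeff n) (hj ?_)
    have h1 : j (p.coeff n) = φ ((g t).coeff n) := by rw [← coeff_map, hpt, coeff_map]
    rw [map_zero, ← eval₂_at_apply, eval₂_map, ← hφρ, h1, ← hom_eval₂]
    have := minpoly.aeval L[X] ((g t).coeff n)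
    rw [aeval_def] at this
    rw [this, map_zero]
  obtain ⟨P, hP, hPd, hPm⟩ := lifts_and_natDegree_eq_and_monic hlift (hg t)
  have hPF : P ∣ F := by
    rw [← map_dvd_map ρ hρ hPm, hP, hβ]
    exact Finset.prod_dvd_prod_of_subset _ _ _ (Finset.subset_univ t)
  have hPd' : P.natDegree = p.natDegree := by rw [hPd, hgd, hpd]
  rcases (hi.dvd_iff).1 hPF with h1 | h1
  · left
    rw [← hp.natDegree_eq_zero, ← hPd', hPm.natDegree_eq_zero]
    exact hPm.eq_one_of_isUnit h1
  · right
    rw [← hq.natDegree_eq_zero]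
    have h2 := eq_of_monic_of_associated hPm hm h1.symm
    have h3 := hp.natDegree_mul hq
    rw [hpq, hm.natDegree_map, ← hPd', h2] at h3
    omega

theorem Polynomial.isLocalHom_mapRingHom {R S : Type*} [CommRing R] [CommRing S] [IsDomain R]
    [IsDomain S] {φ : R →+* S} (hφ : Function.Injective φ) [IsLocalHom φ] :
    IsLocalHom (mapRingHom φ) := by
  refine ⟨fun p hp => ?_⟩
  have h0 : p.natDegree = 0 := by
    rw [← natDegree_map_eq_of_injective hφ]
    exact natDegree_eq_zero_of_isUnit hp
  rw [eq_C_of_natDegree_eq_zero h0, coe_mapRingHom, map_C] at hp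
  rw [eq_C_of_natDegree_eq_zero h0]
  exact (isUnit_of_map_unit φ _ (isUnit_C.1 hp)).map C

theorem irreducible_of_irreducible_map_mapRingHom {k l : Type*} [Field k] [Field l]
    {φ : k →+* l} {f : k[X][X]} (h : Irreducible (f.map (mapRingHom φ))) : Irreducible f := by
  have := isLocalHom_mapRingHom φ.injective
  have := isLocalHom_mapRingHom (φ := mapRingHom φ) (map_injective φ φ.injective)
  exact Irreducible.of_map (f := mapRingHom (mapRingHom φ)) h

theorem Irreducible.scaleRoots {F : Type*} [Field F] {p : F[X]} (hp : Irreducible p) {r : F}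
    (hr : r ≠ 0) : Irreducible (p.scaleRoots r) := by
  have key : ∀ {q : F[X]} {s : F}, s ≠ 0 → IsUnit q → IsUnit (q.scaleRoots s) := by
    intro q s hs hq
    obtain ⟨a, ha, rfl⟩ := isUnit_iff.1 hq
    simpa using hq
  have hback : ∀ q : F[X], (q.scaleRoots r).scaleRoots r⁻¹ = q := by
    intro q
    rw [← scaleRoots_mul, mul_inv_cancel₀ hr, scaleRoots_one]
  have hback' : ∀ q : F[X], (q.scaleRoots r⁻¹).scaleRoots r = q := by
    intro q
    rw [← scaleRoots_mul, inv_mul_cancel₀ hr, scaleRoots_one]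
  refine ⟨fun h => hp.not_isUnit ?_, fun a b hab => ?_⟩
  · rw [← hback p]
    exact key (inv_ne_zero hr) h
  · have h1 : p = a.scaleRoots r⁻¹ * b.scaleRoots r⁻¹ := by
      rw [← mul_scaleRoots_of_noZeroDivisors, ← hab, hback]
    refine (hp.isUnit_or_isUnit h1).imp (fun h => ?_) fun h => ?_
    · rw [← hback' a]; exact key hr h
    · rw [← hback' b]; exact key hr h

theorem irreducible_integralNormalization {R : Type*} [CommRing R] [IsDomain R]
    [UniqueFactorizationMonoid R] {f : R[X]} (hf : Irreducible f) (hd : f.natDegree ≠ 0) :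
    Irreducible (integralNormalization f) := by
  rw [(monic_integralNormalization hf.ne_zero).irreducible_iff_irreducible_map_fraction_map
    (K := FractionRing R)]
  have h1 := ((hf.isPrimitive hd).irreducible_iff_irreducible_map_fraction_map
    (K := FractionRing R)).1 hf
  have hlc : algebraMap R (FractionRing R) f.leadingCoeff ≠ 0 := by
    simpa using hf.ne_zero
  have h2 := congrArg (Polynomial.map (algebraMap R (FractionRing R)))
    (integralNormalization_mul_C_leadingCoeff f)
  rw [map_scaleRoots _ _ _ hlc, Polynomial.map_mul, map_C] at h2
  have h3 := h1.scaleRoots hlc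
  rw [← h2] at h3
  exact (irreducible_mul_isUnit (isUnit_C.2 hlc.isUnit)).1 h3

/-- A root of a polynomial that stays irreducible over `L` generates an extension meeting `L`
trivially. -/
theorem adjoin_simple_inf_eq_bot {K Ω : Type*} [Field K] [Field Ω] [Algebra K Ω]
    (L : IntermediateField K Ω) [FiniteDimensional K L] {z : Ω} {G : K[X]} (hm : G.Monic)
    (hi : Irreducible (G.map (algebraMap K L))) (hz : aeval z G = 0) :
    IntermediateField.adjoin K {z} ⊓ L = ⊥ := by
  have hzL : aeval z (G.map (algebraMap K L)) = 0 := by rwa [aeval_map_algebraMap]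
  have hGK : G = minpoly K z :=
    minpoly.eq_of_irreducible_of_monic (hm.irreducible_of_irreducible_map _ _ hi) hz hm
  have hGL := minpoly.eq_of_irreducible_of_monic hi hzL (hm.map _)
  have hiK : IsIntegral K z := ⟨G, hm, hz⟩
  have : FiniteDimensional K (IntermediateField.adjoin K {z}) :=
    IntermediateField.adjoin.finiteDimensional hiK
  rw [inf_comm]
  refine (IntermediateField.LinearDisjoint.of_finrank_sup ?_).inf_eq_bot
  rw [← IntermediateField.restrictScalars_adjoin_eq_sup, IntermediateField.adjoin.finrank hiK, ← hGK]
  have h1 := Module.finrank_mul_finrank K L (IntermediateField.adjoin L {z})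
  rw [IntermediateField.adjoin.finrank hiK.tower_top, ← hGL, hm.natDegree_map] at h1
  exact h1.symm

/-- An irreducible bivariate polynomial over a number field has a zero whose coordinates generate
an extension meeting a given finite extension trivially. -/
theorem exists_zero_adjoin_inf_eq_bot {K Ω : Type*} [Field K] [NumberField K] [Field Ω]
    [IsAlgClosed Ω] [Algebra K Ω] (L : IntermediateField K Ω) [FiniteDimensional K L]
    {f : K[X][X]} (hf : Irreducible (f.map (mapRingHom (algebraMap K Ω))))
    (hd : f.natDegree ≠ 0) :
    ∃ (x : K) (y : Ω), aeval y (f.map (evalRingHom x)) = 0 ∧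
      IntermediateField.adjoin K {y} ⊓ L = ⊥ := by
  have : CharZero L := charZero_of_injective_algebraMap (algebraMap K L).injective
  have : CharZero Ω := charZero_of_injective_algebraMap (algebraMap K Ω).injective
  have : NumberField L := NumberField.of_module_finite K L
  set g : L[X][X] := f.map (mapRingHom (algebraMap K L)) with hg
  have hgΩ : g.map (mapRingHom (algebraMap L Ω)) = f.map (mapRingHom (algebraMap K Ω)) := by
    rw [hg, Polynomial.map_map, mapRingHom_comp, ← IsScalarTower.algebraMap_eq]
  have hgi : Irreducible g := irreducible_of_irreducible_map_mapRingHom (hgΩ ▸ hf)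
  have hfi : Irreducible f := irreducible_of_irreducible_map_mapRingHom hf
  have hψ : Function.Injective (mapRingHom (algebraMap K L)) :=
    map_injective _ (algebraMap K L).injective
  have hgd : g.natDegree ≠ 0 := by rwa [hg, natDegree_map_eq_of_injective hψ]
  obtain ⟨N, hN⟩ := exists_nat_forall_ge_eval_ne_zero (leadingCoeff_ne_zero.2 hfi.ne_zero)
  obtain ⟨n, hn, hirr⟩ := NumberField.exists_nat_irreducible_map_evalRingHom
    (monic_integralNormalization hgi.ne_zero) (irreducible_integralNormalization hgi hgd) N
  set x : K := (n : K)
  have hlc : evalRingHom x f.leadingCoeff ≠ 0 := hN n hn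
  set F : K[X] := f.map (evalRingHom x) with hF
  have hFd : F.natDegree = f.natDegree := natDegree_map_of_leadingCoeff_ne_zero _ hlc
  have hFl : F.leadingCoeff ≠ 0 := by
    rw [hF, leadingCoeff_map_of_leadingCoeff_ne_zero _ hlc]
    exact hlc
  have hF0 : F ≠ 0 := leadingCoeff_ne_zero.1 hFl
  have hFL : F.integralNormalization.map (algebraMap K L) =
      g.integralNormalization.map (evalRingHom (n : L)) := by
    have hlcg : mapRingHom (algebraMap K L) f.leadingCoeff ≠ 0 := by
      rw [Ne, map_eq_zero_iff _ hψ]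
      exact leadingCoeff_ne_zero.2 hfi.ne_zero
    rw [hF, integralNormalization_map _ _ hlc, hg, integralNormalization_map _ _ hlcg,
      Polynomial.map_map, Polynomial.map_map]
    congr 1
    ext <;> simp [x]
  obtain ⟨z, hz⟩ := IsAlgClosed.exists_aeval_eq_zero Ω F.integralNormalization (by
    rw [degree_integralNormalization]
    intro h
    exact hd (hFd ▸ natDegree_eq_of_degree_eq_some h))
  have hbot := adjoin_simple_inf_eq_bot L (monic_integralNormalization hF0) (hFL ▸ hirr) hz
  have ha : algebraMap K Ω F.leadingCoeff ≠ 0 := by simpa using hF0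
  refine ⟨x, (algebraMap K Ω F.leadingCoeff)⁻¹ * z, ?_, ?_⟩
  · have h1 := integralNormalization_eval₂_leadingCoeff_mul (p := F) (by omega) (algebraMap K Ω)
      ((algebraMap K Ω F.leadingCoeff)⁻¹ * z)
    rw [mul_inv_cancel_left₀ ha, ← aeval_def, hz] at h1
    exact (mul_eq_zero.1 h1.symm).resolve_left (pow_ne_zero _ ha)
  · refine le_bot_iff.1 (le_trans (inf_le_inf_right L ?_) hbot.le)
    rw [IntermediateField.adjoin_simple_le_iff]
    exact mul_mem (inv_mem (algebraMap_mem _ _)) (IntermediateField.mem_adjoin_simple_self K z)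

instance : Algebra.IsAlgebraic ℚ Qbar := by
  convert AlgebraicClosure.isAlgebraic ℚ
  · rfl
  · exact Subsingleton.elim _ _

instance (K : Subfield Qbar) : Algebra.IsAlgebraic K Qbar :=
  Algebra.IsAlgebraic.tower_top (K := ℚ) K

instance : Countable Qbar := by
  rw [← Cardinal.mk_le_aleph0_iff]
  exact (Algebra.IsAlgebraic.cardinalMk_le_max ℚ Qbar).trans (by simp)

instance {R : Type*} [CommSemiring R] [Countable R] : Countable R[X] := by
  rw [← Cardinal.mk_le_aleph0_iff]
  exact Polynomial.cardinalMk_le_max.trans (by simp)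

instance {R σ : Type*} [CommSemiring R] [Countable R] [Countable σ] :
    Countable (MvPolynomial σ R) := by
  rw [← Cardinal.mk_le_aleph0_iff]
  exact MvPolynomial.cardinalMk_le_max_lift.trans (by simp)

theorem isOpen_setOf_mem (a : Qbar) : IsOpen {F : Subfield Qbar | a ∈ F} := by
  let _ : TopologicalSpace Prop := propDiscrete
  refine (@isOpen_induced_iff _ _ powersetTopology _ _).2 ⟨{S : Set Qbar | a ∈ S}, ?_, rfl⟩
  exact (continuous_apply (A := fun _ : Qbar => Prop) a).isOpen_preimage {p | p} trivial

theorem isOpen_setOf_notMem (a : Qbar) : IsOpen {F : Subfield Qbar | a ∉ F} := by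
  let _ : TopologicalSpace Prop := propDiscrete
  refine (@isOpen_induced_iff _ _ powersetTopology _ _).2 ⟨{S : Set Qbar | a ∉ S}, ?_, rfl⟩
  exact (continuous_apply (A := fun _ : Qbar => Prop) a).isOpen_preimage {p | ¬ p} trivial

/-- Membership in an open set of subfields is guaranteed by finitely many elements. -/
theorem exists_finset_forall_mem_of_isOpen {W : Set (Subfield Qbar)} (hW : IsOpen W)
    {F₀ : Subfield Qbar} (h₀ : F₀ ∈ W) :
    ∃ I : Finset Qbar, ∀ F : Subfield Qbar, (∀ a ∈ I, a ∈ F ↔ a ∈ F₀) → F ∈ W := by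
  obtain ⟨V, hV, rfl⟩ := (@isOpen_induced_iff _ _ powersetTopology _ _).1 hW
  let _ : TopologicalSpace Prop := propDiscrete
  obtain ⟨I, u, hu, hIV⟩ := isOpen_pi_iff.1 hV (F₀ : Set Qbar) h₀
  refine ⟨I, fun F hF => hIV fun a ha => ?_⟩
  have h := (hu a ha).2
  have e : (F : Set Qbar) a = (F₀ : Set Qbar) a := propext (hF a ha)
  change (F : Set Qbar) a ∈ u a
  rwa [e]

theorem exists_numberField_le (F₀ : Subfield Qbar) {A : Set Qbar} (hA : A.Finite)
    (hAF : A ⊆ F₀) : ∃ K : Subfield Qbar, NumberField K ∧ A ⊆ K ∧ K ≤ F₀ := by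
  let K := IntermediateField.adjoin ℚ A
  have hfin : FiniteDimensional ℚ K := by
    have := hA.to_subtype
    exact IntermediateField.finiteDimensional_adjoin fun x _ => Algebra.IsIntegral.isIntegral x
  refine ⟨K.toSubfield, @NumberField.mk _ _ _ hfin, IntermediateField.subset_adjoin ℚ A, ?_⟩
  rw [IntermediateField.adjoin_toSubfield, Subfield.closure_le]
  rintro x (⟨q, rfl⟩ | hx)
  · simp
  · exact hAF hx

/-- An open condition on subfields holds generically, among the subfields containing a finite set
`A`, once every number field containing `A` has an extension with this condition avoiding finitely
many prescribed elements. -/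
theorem eventually_residual_of_numberField {A : Set Qbar} (hA : A.Finite)
    {Q : Set (Subfield Qbar)} (hQ : IsOpen Q)
    (h : ∀ (K : Subfield Qbar) [NumberField K], A ⊆ K → ∀ B : Set Qbar, B.Finite →
      (∀ b ∈ B, b ∉ K) → ∃ F ∈ Q, K ≤ F ∧ ∀ b ∈ B, b ∉ F) :
    ∀ᶠ F : Subfield Qbar in residual (Subfield Qbar), A ⊆ (F : Set Qbar) → F ∈ Q := by
  refine residual_of_dense_open ?_ (dense_iff_inter_open.2 ?_)
  · have e : {F : Subfield Qbar | A ⊆ (F : Set Qbar) → F ∈ Q} = (⋃ a ∈ A, {F | a ∉ F}) ∪ Q := by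
      ext F
      simp only [Set.mem_ofPred_eq, Set.mem_union, Set.mem_iUnion, imp_iff_not_or,
        Set.not_subset, SetLike.mem_coe, exists_prop]
    change IsOpen {F : Subfield Qbar | A ⊆ (F : Set Qbar) → F ∈ Q}
    rw [e]
    exact (isOpen_biUnion fun a _ => isOpen_setOf_notMem a).union hQ
  · rintro W hW ⟨F₀, h₀⟩
    by_cases hAF : A ⊆ F₀
    · obtain ⟨I, hI⟩ := exists_finset_forall_mem_of_isOpen hW h₀
      obtain ⟨K, hK, hAK, hKF⟩ := exists_numberField_le F₀
        (hA.union (I.finite_toSet.inter_of_left F₀))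
        (Set.union_subset hAF Set.inter_subset_right)
      obtain ⟨F, hF, hle, hd⟩ := h K (Set.subset_union_left.trans hAK) (I \ F₀)
        I.finite_toSet.sdiff fun b hb hbK => hb.2 (hKF hbK)
      exact ⟨F, hI F fun a ha => ⟨fun haF => by_contra fun h' => hd a ⟨ha, h'⟩ haF,
        fun haF => hle (hAK (Or.inr ⟨ha, haF⟩))⟩, fun _ => hF⟩
    · exact ⟨F₀, h₀, fun h' => absurd h' hAF⟩

/-- **Hilbert's irreducibility theorem**: number fields are Hilbertian. -/
theorem isHilbertian_of_numberField (K : Subfield Qbar) [NumberField K] : IsHilbertian K := by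
  classical
  intro n _ f g hf hm hd hg
  obtain ⟨N, hN⟩ := exists_nat_forall_ge_eval_ne_zero hg
  obtain ⟨x, hx, h⟩ := NumberField.exists_nat_forall_eval_ne_zero (Finset.univ.image f)
    (by simpa using hm) (by simpa using fun i => irreducible_of_irreducible_map_mapRingHom (hf i))
    (by simpa using hd) N
  exact ⟨x, hN x hx, fun i y => h (f i) (by simp) y⟩

theorem eval_map_evalRingHom_map {R S : Type*} [CommRing R] [CommRing S] (φ : R →+* S)
    (p : R[X][X]) (x y : R) :
    ((p.map (mapRingHom φ)).map (evalRingHom (φ x))).eval (φ y) =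
      φ ((p.map (evalRingHom x)).eval y) := by
  rw [map_evalRingHom_eval, map_mapRingHom_evalEval, map_evalRingHom_eval]

theorem exists_map_eq_of_coeffs_subset {K : Subfield Qbar} {p : Qbar[X]}
    (h : (p.coeffs : Set Qbar) ⊆ K) : ∃ q : K[X], q.map K.subtype = p :=
  (mem_lifts p).1 ((lifts_iff_coeffs_subset_range p).2 (by simpa using h))

theorem exists_map_mapRingHom_eq_of_coeff_mem {K : Subfield Qbar} {p : Qbar[X][X]}
    (h : ∀ i j, (p.coeff i).coeff j ∈ K) : ∃ q : K[X][X], q.map (mapRingHom K.subtype) = p :=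
  (mem_lifts p).1 ((lifts_iff_coeff_lifts p).2 fun i =>
    (mem_lifts (p.coeff i)).1 ((lifts_iff_coeff_lifts _).2 fun j => ⟨⟨_, h i j⟩, rfl⟩))

theorem isOpen_setOf_exists_zero (f : MvPolynomial (Fin 2) Qbar) :
    IsOpen {F : Subfield Qbar | ∃ x ∈ F, ∃ y ∈ F, MvPolynomial.eval ![x, y] f = 0} := by
  have e : {F : Subfield Qbar | ∃ x ∈ F, ∃ y ∈ F, MvPolynomial.eval ![x, y] f = 0} =
      ⋃ (x : Qbar) (y : Qbar) (_ : MvPolynomial.eval ![x, y] f = 0),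
        {F : Subfield Qbar | x ∈ F} ∩ {F : Subfield Qbar | y ∈ F} := by
    ext F
    simp only [Set.mem_ofPred_eq, Set.mem_iUnion, Set.mem_inter_iff, exists_prop]
    exact exists_congr fun x => ⟨fun ⟨hx, y, hy, h⟩ => ⟨y, h, hx, hy⟩,
      fun ⟨y, h, hx, hy⟩ => ⟨hx, y, hy, h⟩⟩
  rw [e]
  exact isOpen_iUnion fun x => isOpen_iUnion fun y => isOpen_iUnion fun _ =>
    (isOpen_setOf_mem x).inter (isOpen_setOf_mem y)

theorem isOpen_setOf_exists_forall_eval_ne_zero {n : ℕ} {f : Fin n → Qbar[X][X]}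
    (hf : ∀ i, (f i).Monic) (g : Qbar[X]) :
    IsOpen {F : Subfield Qbar | ∃ x ∈ F, g.eval x ≠ 0 ∧
      ∀ i, ∀ y ∈ F, ((f i).map (evalRingHom x)).eval y ≠ 0} := by
  classical
  have e : {F : Subfield Qbar | ∃ x ∈ F, g.eval x ≠ 0 ∧
      ∀ i, ∀ y ∈ F, ((f i).map (evalRingHom x)).eval y ≠ 0} =
      ⋃ (x : Qbar) (_ : g.eval x ≠ 0), {F : Subfield Qbar | x ∈ F} ∩
        ⋂ i, ⋂ y ∈ ((f i).map (evalRingHom x)).roots.toFinset, {F : Subfield Qbar | y ∉ F} := by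
    ext F
    simp only [Set.mem_ofPred_eq, Set.mem_iUnion, Set.mem_inter_iff, Set.mem_iInter,
      Multiset.mem_toFinset, mem_roots ((hf _).map _).ne_zero, IsRoot.def, exists_prop]
    exact exists_congr fun x => ⟨fun h => ⟨h.2.1, h.1, fun i y hy hyF => h.2.2 i y hyF hy⟩,
      fun h => ⟨h.2.1, h.1, fun i y hyF hy => h.2.2 i y hy hyF⟩⟩
  rw [e]
  exact isOpen_iUnion fun x => isOpen_iUnion fun _ => (isOpen_setOf_mem x).inter <|
    isOpen_iInter_of_finite fun i => isOpen_biInter_finset fun y _ => isOpen_setOf_notMem y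

theorem eventually_isHilbertian : ∀ᶠ F in residual (Subfield Qbar), IsHilbertian F := by
  have H (n : ℕ) (hn : 0 < n) (f : Fin n → Qbar[X][X]) (g : Qbar[X])
      (hf : ∀ i, Irreducible (f i)) (hm : ∀ i, (f i).Monic) (hd : ∀ i, 2 ≤ (f i).natDegree)
      (hg : g ≠ 0) : ∀ᶠ F : Subfield Qbar in residual (Subfield Qbar),
      ((⋃ i, ⋃ p ∈ (f i).coeffs, (p.coeffs : Set Qbar)) ∪ (g.coeffs : Set Qbar)) ⊆ (F : Set Qbar) →
        F ∈ {F : Subfield Qbar | ∃ x ∈ F, g.eval x ≠ 0 ∧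
          ∀ i, ∀ y ∈ F, ((f i).map (evalRingHom x)).eval y ≠ 0} := by
    refine eventually_residual_of_numberField ?_
      (isOpen_setOf_exists_forall_eval_ne_zero hm g) fun K _ hK B _ hB => ⟨K, ?_, le_rfl, hB⟩
    · exact (Set.finite_iUnion fun i => Set.Finite.biUnion (Finset.finite_toSet _)
        fun p _ => Finset.finite_toSet _).union (Finset.finite_toSet _)
    · obtain ⟨g, rfl⟩ := exists_map_eq_of_coeffs_subset (Set.subset_union_right.trans hK)
      have hf' (i) : ∃ q : K[X][X], q.map (mapRingHom K.subtype) = f i := by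
        refine exists_map_mapRingHom_eq_of_coeff_mem fun j k => ?_
        by_cases h : ((f i).coeff j).coeff k = 0
        · rw [h]; exact K.zero_mem
        · refine hK (Or.inl (Set.mem_iUnion.2 ⟨i, Set.mem_biUnion (x := (f i).coeff j) ?_ ?_⟩))
          · exact coeff_mem_coeffs fun h' => h (by simp [h'])
          · exact coeff_mem_coeffs h
      choose q hq using hf'
      obtain rfl : (fun i => (q i).map (mapRingHom K.subtype)) = f := funext hq
      have hinj : Function.Injective (mapRingHom K.subtype) :=
        map_injective _ K.subtype.injective
      obtain ⟨x, hx, h⟩ := isHilbertian_of_numberField K n hn q g hf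
        (fun i => monic_of_injective hinj (hm i))
        (fun i => by simpa [natDegree_map_eq_of_injective hinj] using hd i)
        (by rintro rfl; simp at hg)
      refine ⟨x, x.2, ?_, fun i y hy => ?_⟩
      · change eval (K.subtype x) _ ≠ 0
        rw [eval_map_apply]
        simpa using hx
      · change eval (K.subtype ⟨y, hy⟩) (Polynomial.map (evalRingHom (K.subtype x)) _) ≠ 0
        rw [eval_map_evalRingHom_map]
        simpa using h i ⟨y, hy⟩
  simp only [← eventually_countable_forall] at H
  filter_upwards [H] with F hF n hn f g hf hm hd hg
  have hinj : Function.Injective (mapRingHom F.subtype) := map_injective _ F.subtype.injective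
  obtain ⟨x, hxF, hx, h⟩ := hF n hn (fun i => (f i).map (mapRingHom F.subtype))
    (g.map F.subtype) hf (fun i => (hm i).map _)
    (fun i => by simpa [natDegree_map_eq_of_injective hinj] using hd i)
    (by simpa [Polynomial.map_eq_zero_iff F.subtype.injective] using hg) (by
      refine Set.union_subset (Set.iUnion_subset fun i => Set.iUnion₂_subset fun p hp a ha => ?_)
        fun a ha => ?_
      · obtain ⟨j, -, rfl⟩ := mem_coeffs_iff.1 hp
        obtain ⟨k, -, rfl⟩ := mem_coeffs_iff.1 ha
        simp
      · obtain ⟨k, -, rfl⟩ := mem_coeffs_iff.1 ha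
        simp)
  refine ⟨⟨x, hxF⟩, fun h0 => hx ?_, fun i y h0 => h i y y.2 ?_⟩
  · have := eval_map_apply F.subtype (p := g) (⟨x, hxF⟩ : F)
    rw [h0, map_zero] at this
    exact this
  · have := eval_map_evalRingHom_map F.subtype (f i) ⟨x, hxF⟩ y
    rw [h0, map_zero] at this
    exact this

theorem equivMvPolynomial_symm_map {R S : Type*} [CommRing R] [CommRing S] (φ : R →+* S)
    (f : MvPolynomial (Fin 2) R) :
    (Bivariate.equivMvPolynomial S).symm (MvPolynomial.map φ f) =
      ((Bivariate.equivMvPolynomial R).symm f).map (mapRingHom φ) := by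
  induction f using MvPolynomial.induction_on with
  | C a => simp
  | add p q hp hq => simp [hp, hq]
  | mul_X p i hp => fin_cases i <;> simp [hp]

theorem eval_eq_eval_equivMvPolynomial_symm {R : Type*} [CommRing R]
    (f : MvPolynomial (Fin 2) R) (x y : R) :
    MvPolynomial.eval ![x, y] f =
      (((Bivariate.equivMvPolynomial R).symm f).map (evalRingHom x)).eval y := by
  induction f using MvPolynomial.induction_on with
  | C a => simp
  | add p q hp hq => simp [hp, hq]
  | mul_X p i hp => fin_cases i <;> simp [hp]

/-- Over a number field `K`, an absolutely irreducible plane curve has a point in an extension of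
`K` inside `Qbar` that avoids finitely many prescribed elements outside `K`. -/
theorem exists_subfield_eval_eq_zero (K : Subfield Qbar) [NumberField K] {f : K[X][X]}
    (hf : Irreducible (f.map (mapRingHom K.subtype))) {B : Set Qbar} (hB : B.Finite)
    (hBK : ∀ b ∈ B, b ∉ K) :
    ∃ F : Subfield Qbar, (∃ x ∈ F, ∃ y ∈ F,
      ((f.map (mapRingHom K.subtype)).map (evalRingHom x)).eval y = 0) ∧
        K ≤ F ∧ ∀ b ∈ B, b ∉ F := by
  have hinj : Function.Injective (mapRingHom K.subtype) := map_injective _ K.subtype.injective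
  by_cases hd : f.natDegree = 0
  · obtain ⟨p, rfl⟩ := natDegree_eq_zero.1 hd
    have hp : Irreducible (p.map K.subtype) := by
      rw [map_C] at hf
      exact hf.of_map (f := (C : Qbar[X] →+* _))
    have hp1 := IsAlgClosed.degree_eq_one_of_irreducible Qbar hp
    obtain ⟨x, hx⟩ := exists_root_of_degree_eq_one (p := p) (by rwa [degree_map] at hp1)
    refine ⟨K, ⟨x, x.2, 0, K.zero_mem, ?_⟩, le_rfl, hBK⟩
    have := eval_map_apply K.subtype (p := p) x
    rw [hx.eq_zero, map_zero] at this
    simpa using this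
  · have := hB.to_subtype
    have hfin : FiniteDimensional K (IntermediateField.adjoin K B) :=
      IntermediateField.finiteDimensional_adjoin fun x _ => Algebra.IsIntegral.isIntegral x
    obtain ⟨x, y, hy, hinf⟩ :=
      exists_zero_adjoin_inf_eq_bot (Ω := Qbar) (IntermediateField.adjoin K B) hf hd
    refine ⟨(IntermediateField.adjoin K {y}).toSubfield, ⟨x, ?_, y, ?_, ?_⟩, ?_, ?_⟩
    · exact (IntermediateField.adjoin K {y}).algebraMap_mem x
    · exact IntermediateField.mem_adjoin_simple_self K y
    · rw [aeval_def, eval₂_eq_eval_map] at hy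
      rw [← hy, Polynomial.map_map, Polynomial.map_map]
      congr 2
      ext <;> simp <;> rfl
    · exact fun a ha => (IntermediateField.adjoin K {y}).algebraMap_mem ⟨a, ha⟩
    · intro b hb hbF
      have : b ∈ IntermediateField.adjoin K {y} ⊓ IntermediateField.adjoin K B :=
        ⟨hbF, IntermediateField.subset_adjoin K B hb⟩
      rw [hinf, IntermediateField.mem_bot] at this
      obtain ⟨c, rfl⟩ := this
      exact hBK _ hb c.2

theorem eventually_isPAC : ∀ᶠ F in residual (Subfield Qbar), IsPAC F := by
  have H (f : MvPolynomial (Fin 2) Qbar) (hf : Irreducible f) :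
      ∀ᶠ F : Subfield Qbar in residual (Subfield Qbar), (f.coeffs : Set Qbar) ⊆ (F : Set Qbar) →
        F ∈ {F : Subfield Qbar | ∃ x ∈ F, ∃ y ∈ F, MvPolynomial.eval ![x, y] f = 0} := by
    refine eventually_residual_of_numberField (Finset.finite_toSet _)
      (isOpen_setOf_exists_zero f) fun K _ hK B hB hBK => ?_
    obtain ⟨f, rfl⟩ := MvPolynomial.mem_range_map_iff_coeffs_subset.2
      (show (f.coeffs : Set Qbar) ⊆ Set.range K.subtype by simpa using hK)
    have h := (MulEquiv.irreducible_iff (Bivariate.equivMvPolynomial Qbar).symm).2 hf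
    rw [equivMvPolynomial_symm_map] at h
    simpa only [Set.mem_ofPred_eq, eval_eq_eval_equivMvPolynomial_symm, equivMvPolynomial_symm_map]
      using exists_subfield_eval_eq_zero K h hB hBK
  simp only [← eventually_countable_forall] at H
  filter_upwards [H] with F hF f hf
  obtain ⟨x, hx, y, hy, h⟩ := hF _ hf (fun a ha => by
    obtain ⟨m, -, rfl⟩ := MvPolynomial.mem_coeffs_iff.1 ha
    simp [MvPolynomial.coeff_map])
  refine ⟨⟨x, hx⟩, ⟨y, hy⟩, F.subtype.injective ?_⟩
  rw [eval_eq_eval_equivMvPolynomial_symm, equivMvPolynomial_symm_map] at h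
  rw [eval_eq_eval_equivMvPolynomial_symm, ← eval_map_evalRingHom_map, map_zero, ← h]
  rfl

end

/-- The set of subfields of `Q̄` that are both PAC and Hilbertian is comeager
in the space `𝓔` of all subfields of `Q̄`. -/
theorem comeager_pac_and_hilbertian :
    {F : Subfield Qbar | IsPAC F ∧ IsHilbertian F} ∈ residual (Subfield Qbar) := by
  exact eventually_isPAC.and eventually_isHilbertian
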